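/- arXiv:2001.10882 — 8 statements merged into one kernel-verified Lean document; each statement's English description precedes it below -/
import Mathlib

section
/- A point x ∈ ℝ^{n-1} is a critical point of the signed area function f (i.e. the Fréchet derivative of f at x is zero) if and only if cos(x_i) = cos(∑_{j=1}^{n-1} x_j) for every i = 1, …, n−1 (equivalently, all the central angles α_1, …, α_n have equal absolute value modulo 2π). -/
open Real

/-- The Fréchet derivative of the signed area function `∑ sin (y i) - sin (∑ y i)`. -/
theorem hasFDerivAt_sum_sin_sub_sin_sum {ι : Type*} [Fintype ι] (x : ι → ℝ) :
    HasFDerivAt (fun y : ι → ℝ => (∑ i, Real.sin (y i)) - Real.sin (∑ i, y i))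
      ((∑ i, Real.cos (x i) • ContinuousLinearMap.proj (R := ℝ) (φ := fun _ : ι => ℝ) i) -
        Real.cos (∑ j, x j) •
          ∑ i, ContinuousLinearMap.proj (R := ℝ) (φ := fun _ : ι => ℝ) i) x := by
  have hproj (i : ι) : HasFDerivAt (fun y : ι → ℝ => y i)
      (ContinuousLinearMap.proj (R := ℝ) (φ := fun _ : ι => ℝ) i) x := hasFDerivAt_apply i x
  exact (HasFDerivAt.fun_sum fun i _ => (hproj i).sin).sub
    (HasFDerivAt.fun_sum fun i _ => hproj i).sin

/-- A point `x ∈ ℝ^{n-1}` is a critical point of the signed area function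
`f(x) = ∑ sin(x i) - sin(∑ x i)` iff `cos (x i) = cos (∑ x j)` for all `i`. -/
theorem critical_point_iff (n : ℕ) (hn : 3 ≤ n) (x : Fin (n - 1) → ℝ) :
    fderiv ℝ (fun y : Fin (n - 1) → ℝ =>
      (∑ i, Real.sin (y i)) - Real.sin (∑ i, y i)) x = 0 ↔
    ∀ i, Real.cos (x i) = Real.cos (∑ j, x j) := by
  rw [(hasFDerivAt_sum_sin_sub_sin_sum x).fderiv]
  constructor
  · intro h i
    have hi := DFunLike.congr_fun h (Pi.single i 1)
    simpa [Pi.single_apply, sub_eq_zero] using hi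
  · intro h
    simp_rw [h, ← Finset.smul_sum, sub_self]
end

section
/- Fix integers n ≥ 3, b ≥ 1 and f ≥ 2 with b + f = n, and a real number p. Let N = n − 1, let S be a subset of {1, …, N} with |S| = b, and let M be the N × N real symmetric matrix with off-diagonal entries M_{ij} = −p (i ≠ j), diagonal entries M_{ii} = 0 for i ∈ S and M_{ii} = −2p for i ∉ S. Then the characteristic polynomial of M equals (X² + (b+f−1)pX + (b−f)p²)·(X − p)^{b−1}·(X + p)^{f−2}. In particular the characteristic polynomial does not depend on the choice of the set S. -/
open Finset in
/-- Determinant of a constant rank-one perturbation of an invertible diagonal matrix. -/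
theorem Matrix.det_diagonal_add_const {ι K : Type*} [Fintype ι] [DecidableEq ι] [Field K]
    (d : ι → K) (hd : ∀ i, d i ≠ 0) (c : K) :
    (Matrix.diagonal d + Matrix.of fun _ _ => c).det = (∏ i, d i) * (1 + c * ∑ i, (d i)⁻¹) := by
  have h : Matrix.diagonal d + Matrix.of (fun _ _ => c) =
      Matrix.diagonal d * (1 + Matrix.replicateCol Unit (fun i => (d i)⁻¹) *
        Matrix.replicateRow Unit fun _ => c) := by
    ext i j
    rw [Matrix.diagonal_mul]
    rcases eq_or_ne i j with rfl | hij
    · simp [Matrix.mul_apply, mul_add, mul_inv_cancel_left₀ (hd i)]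
    · simp [Matrix.mul_apply, hij, mul_inv_cancel_left₀ (hd i)]
  rw [h, Matrix.det_mul, Matrix.det_diagonal, Matrix.det_one_add_replicateCol_mul_replicateRow]
  simp [dotProduct, mul_sum]

open Finset in
/-- Determinant of the sum of a constant matrix and a diagonal matrix with two nonzero values,
with the multiplicities of both values positive. -/
theorem Matrix.det_diagonal_ite_add_const {ι K : Type*} [Fintype ι] [DecidableEq ι] [Field K]
    (S : Finset ι) {k l : ℕ} (hS : #S = k + 1) (hSc : #Sᶜ = l + 1)
    {x y : K} (hx : x ≠ 0) (hy : y ≠ 0) (c : K) :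
    (Matrix.diagonal (fun i => if i ∈ S then x else y) + Matrix.of fun _ _ => c).det =
      (x * y + c * ((k + 1) * y + (l + 1) * x)) * x ^ k * y ^ l := by
  have hSc' : #{i | i ∉ S} = l + 1 := by rw [← hSc]; congr 1; ext; simp
  rw [Matrix.det_diagonal_add_const _ (fun i => by split_ifs <;> assumption)]
  simp only [apply_ite (fun z : K => z⁻¹), prod_ite, sum_ite, prod_const, sum_const,
    filter_univ_mem, hS, hSc', nsmul_eq_mul]
  push_cast
  field_simp
  ring

/-- Characteristic polynomial of the Hessian at a zigzag star: the `(n-1) × (n-1)` matrix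
with off-diagonal entries `-p`, diagonal entries `0` on a set `S` of cardinality `b` and
`-2p` elsewhere, has characteristic polynomial
`(X² + (b+f−1)pX + (b−f)p²) · (X − p)^(b−1) · (X + p)^(f−2)`, independently of `S`. -/
theorem charpoly_zigzag_star (n b f : ℕ) (hn : 3 ≤ n) (hb : 1 ≤ b) (hf : 2 ≤ f)
    (hbf : b + f = n) (p : ℝ) (S : Finset (Fin (n - 1))) (hS : S.card = b) :
    (Matrix.of fun i j : Fin (n - 1) =>
        if i = j then (if i ∈ S then 0 else -2 * p) else -p).charpoly
      = (Polynomial.X ^ 2 + Polynomial.C (((b : ℝ) + (f : ℝ) - 1) * p) * Polynomial.X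
            + Polynomial.C (((b : ℝ) - (f : ℝ)) * p ^ 2))
        * (Polynomial.X - Polynomial.C p) ^ (b - 1)
        * (Polynomial.X + Polynomial.C p) ^ (f - 2) := by
  obtain ⟨k, rfl⟩ : ∃ k, b = k + 1 := ⟨b - 1, by lia⟩
  obtain ⟨l, rfl⟩ : ∃ l, f = l + 2 := ⟨f - 2, by lia⟩
  have hSc : Sᶜ.card = l + 1 := by
    rw [Finset.card_compl, Fintype.card_fin, hS]
    lia
  let φ := algebraMap (Polynomial ℝ) (RatFunc ℝ)
  have hφ : Function.Injective φ := RatFunc.algebraMap_injective ℝ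
  apply hφ
  have hx : φ (Polynomial.X - Polynomial.C p) ≠ 0 :=
    (map_ne_zero_iff φ hφ).2 (Polynomial.X_sub_C_ne_zero p)
  have hy : φ (Polynomial.X + Polynomial.C p) ≠ 0 :=
    (map_ne_zero_iff φ hφ).2 (Polynomial.X_add_C_ne_zero p)
  rw [Matrix.charpoly, RingHom.map_det]
  have key := Matrix.det_diagonal_ite_add_const S hS hSc hx hy (φ (Polynomial.C p))
  convert key using 1
  · congr 1
    ext i j
    rcases eq_or_ne i j with rfl | hij
    · by_cases hi : i ∈ S
      · simp [hi, φ]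
      · simp only [RingHom.mapMatrix_apply, Matrix.map_apply, Matrix.charmatrix_apply_eq,
          Matrix.add_apply, Matrix.diagonal_apply_eq, Matrix.of_apply, hi, if_true, if_false,
          map_sub, map_add, map_mul, map_neg, map_ofNat]
        ring
    · simp [hij, φ]
  · push_cast
    simp only [map_add, map_sub, map_mul, map_pow, map_natCast, map_one,
      map_ofNat]
    ring
end

section
/- Fix integers n ≥ 3, b ≥ 1, f ≥ 2 with b + f = n and a real number p > 0. Let N = n − 1, let S ⊆ {1, …, N} with |S| = b, and let M be the N × N real symmetric matrix with off-diagonal entries −p, diagonal entries 0 on S and −2p off S. Then the number of negative eigenvalues of M, counted with multiplicity, equals f − 1 if f > b, and equals f if f < b; moreover if f = b then 0 is an eigenvalue of M (the Hessian is degenerate). -/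
/-- Determinant of a rank-one perturbation of a two-valued diagonal matrix. -/
lemma det_two_valued_diagonal_add_const {ι : Type*} [Fintype ι] [DecidableEq ι] (S : Finset ι)
    (s t c : ℝ) (hs : s ≠ 0) (ht : t ≠ 0) :
    (Matrix.diagonal (fun i => if i ∈ S then s else t) + Matrix.of fun _ _ : ι => c).det =
      s ^ S.card * t ^ Sᶜ.card * (1 + c * (S.card / s + Sᶜ.card / t)) := by
  have hd : (Matrix.diagonal fun i => if i ∈ S then s else t).det =
      s ^ S.card * t ^ Sᶜ.card := by
    rw [Matrix.det_diagonal, Finset.prod_ite]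
    simp [Finset.filter_not, Finset.compl_eq_univ_sdiff]
  have hinv : (Matrix.diagonal fun i => if i ∈ S then s else t)⁻¹ =
      Matrix.diagonal fun i => if i ∈ S then s⁻¹ else t⁻¹ := by
    apply Matrix.inv_eq_right_inv
    rw [Matrix.diagonal_mul_diagonal, ← Matrix.diagonal_one]
    congr 1
    funext i
    split_ifs <;> simp [hs, ht]
  have hJ : (Matrix.of fun _ _ : ι => c) =
      Matrix.replicateCol Unit (fun _ : ι => c) *
        Matrix.replicateRow Unit (fun _ : ι => (1 : ℝ)) := by
    ext i j
    simp [Matrix.mul_apply]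
  have hsum : ∑ i, (if i ∈ S then s⁻¹ else t⁻¹) * c = c * (S.card / s + Sᶜ.card / t) := by
    rw [← Finset.sum_mul, Finset.sum_ite]
    simp [Finset.filter_not, Finset.compl_eq_univ_sdiff]
    ring
  rw [hJ, Matrix.det_add_replicateCol_mul_replicateRow (by
    rw [hd]
    exact (mul_ne_zero (pow_ne_zero _ hs) (pow_ne_zero _ ht)).isUnit), hd, hinv]
  congr 1
  rw [Matrix.det_unique]
  rw [Matrix.add_apply, Matrix.one_apply_eq, Matrix.mul_apply]
  simp only [Matrix.mul_diagonal, Matrix.replicateRow_apply, Matrix.replicateCol_apply, one_mul,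
    hsum]

open Polynomial in
/-- The characteristic polynomial of the zigzag-star Hessian, with `|S| = k + 1` and
`|Sᶜ| = l + 1`. -/
lemma charpoly_zigzag_star_s4 {ι : Type*} [Fintype ι] [DecidableEq ι] (S : Finset ι) (k l : ℕ)
    (hk : S.card = k + 1) (hl : Sᶜ.card = l + 1) (p : ℝ) :
    (Matrix.of fun i j : ι => if i = j then (if i ∈ S then 0 else -2 * p) else -p).charpoly =
      (X - C p) ^ k * (X - C (-p)) ^ l *
        (X ^ 2 + C (p * (k + l + 2)) * X + C (p ^ 2 * (k - l - 1))) := by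
  apply Polynomial.eq_of_infinite_eval_eq
  refine (Set.Ioi_infinite |p|).mono fun x hx => ?_
  have hx : |p| < x := hx
  have hs : x - p ≠ 0 := (by linarith [le_abs_self p] : 0 < x - p).ne'
  have ht : x + p ≠ 0 := (by linarith [neg_abs_le p] : 0 < x + p).ne'
  have hM : Matrix.scalar ι x -
      (Matrix.of fun i j : ι => if i = j then (if i ∈ S then 0 else -2 * p) else -p) =
      Matrix.diagonal (fun i => if i ∈ S then x - p else x + p) + Matrix.of fun _ _ : ι => p := by
    ext i j
    by_cases hij : i = j
    · subst hij
      by_cases hi : i ∈ S <;> simp [hi]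
      ring
    · simp [hij]
  rw [Set.mem_ofPred_eq, Matrix.eval_charpoly, hM, det_two_valued_diagonal_add_const S _ _ _ hs ht,
    hk, hl]
  simp only [eval_mul, eval_add, eval_sub, eval_pow, eval_X, eval_C]
  push_cast
  field_simp
  ring

open Polynomial in
/-- Number of negative roots of a product of the shape in `charpoly_zigzag_star`. -/
lemma card_neg_roots_of_factorization (k l : ℕ) (p r s : ℝ) (hp : 0 < p) (hr : r < 0) :
    (((X - C p) ^ k * (X - C (-p)) ^ l * ((X - C r) * (X - C s))).roots.filter
      fun x => x < 0).card = l + 1 + if s < 0 then 1 else 0 := by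
  have h1 : (X - C p) ^ k ≠ 0 := pow_ne_zero _ (X_sub_C_ne_zero p)
  have h2 : (X - C (-p)) ^ l ≠ 0 := pow_ne_zero _ (X_sub_C_ne_zero (-p))
  have h3 : (X - C r) * (X - C s) ≠ 0 := mul_ne_zero (X_sub_C_ne_zero r) (X_sub_C_ne_zero s)
  rw [roots_mul (mul_ne_zero (mul_ne_zero h1 h2) h3), roots_mul (mul_ne_zero h1 h2),
    roots_mul h3, roots_pow, roots_pow]
  simp only [roots_X_sub_C, Multiset.filter_add, Multiset.card_add, Multiset.filter_nsmul,
    Multiset.filter_singleton, hr, hp, hp.not_gt, Left.neg_neg_iff, Multiset.card_nsmul, if_true,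
    if_false]
  split_ifs <;> simp [add_assoc]

open Polynomial in
/-- A monic real quadratic taking a negative value at a negative point splits with a negative
root. -/
lemma exists_factorization_of_eval_neg (u v y : ℝ) (hy : y < 0) (h : y ^ 2 + u * y + v < 0) :
    ∃ r s : ℝ, r < 0 ∧ r + s = -u ∧ r * s = v ∧
      X ^ 2 + C u * X + C v = (X - C r) * (X - C s) := by
  have hD : 0 ≤ u ^ 2 - 4 * v := by nlinarith [sq_nonneg (2 * y + u)]
  have hsq := Real.sq_sqrt hD
  have h0 := Real.sqrt_nonneg (u ^ 2 - 4 * v)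
  set d := √(u ^ 2 - 4 * v)
  have hv : (-u - d) / 2 * ((-u + d) / 2) = v := by linear_combination -hsq / 4
  have hu : (-u - d) / 2 + (-u + d) / 2 = -u := by ring
  refine ⟨(-u - d) / 2, (-u + d) / 2, ?_, hu, hv, ?_⟩
  · by_contra! hneg
    nlinarith
  · have hC : C u = -(C ((-u - d) / 2) + C ((-u + d) / 2)) := by
      rw [← C_add, hu, C_neg, neg_neg]
    have hCv : C v = C ((-u - d) / 2) * C ((-u + d) / 2) := by
      rw [← C_mul, hv]
    rw [hC, hCv]
    ring


/-- Morse index at a zigzag star: with `p > 0`, the number of negative eigenvalues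
(counted with multiplicity, as roots of the characteristic polynomial) of the Hessian
matrix equals `f − 1` if `f > b` and `f` if `f < b`; if `f = b` then `0` is an
eigenvalue (the Hessian is degenerate). -/
theorem morse_index_zigzag_star (n b f : ℕ) (hn : 3 ≤ n) (hb : 1 ≤ b) (hf : 2 ≤ f)
    (hbf : b + f = n) (p : ℝ) (hp : 0 < p) (S : Finset (Fin (n - 1))) (hS : S.card = b) :
    let M := Matrix.of fun i j : Fin (n - 1) =>
      if i = j then (if i ∈ S then 0 else -2 * p) else -p
    (b < f → (M.charpoly.roots.filter fun x => x < 0).card = f - 1) ∧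
    (f < b → (M.charpoly.roots.filter fun x => x < 0).card = f) ∧
    (f = b → M.charpoly.IsRoot 0) := by
  intro M
  have hc : Sᶜ.card = (f - 2) + 1 := by
    rw [Finset.card_compl, Fintype.card_fin]
    omega
  obtain ⟨k, rfl⟩ : ∃ k, b = k + 1 := ⟨b - 1, by omega⟩
  obtain ⟨l, rfl⟩ : ∃ l, f = l + 2 := ⟨f - 2, by omega⟩
  have hM := charpoly_zigzag_star_s4 S k l hS hc p
  have hk0 : (0 : ℝ) ≤ k := k.cast_nonneg
  have hl0 : (0 : ℝ) ≤ l := l.cast_nonneg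
  obtain ⟨r, s, hr, hsum, hprod, hq⟩ := exists_factorization_of_eval_neg
    (p * (k + l + 2)) (p ^ 2 * (k - l - 1)) (-p) (by linarith) (by nlinarith [pow_pos hp 2])
  rw [hq] at hM
  refine ⟨fun h => ?_, fun h => ?_, fun h => ?_⟩
  · have hkl : (k : ℝ) < l + 1 := by exact_mod_cast (by omega : k < l + 1)
    have hs : ¬ s < 0 := by
      intro hs
      nlinarith [mul_pos_of_neg_of_neg hr hs, pow_pos hp 2]
    rw [hM, card_neg_roots_of_factorization k l p r s hp hr, if_neg hs]
    rfl
  · have hkl : (l : ℝ) + 1 < k := by exact_mod_cast (by omega : l + 1 < k)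
    have hs : s < 0 := by
      by_contra! hs
      nlinarith [mul_nonneg (neg_nonneg.mpr hr.le) hs, pow_pos hp 2]
    rw [hM, card_neg_roots_of_factorization k l p r s hp hr, if_pos hs]
  · have hkl : (k : ℝ) = l + 1 := by exact_mod_cast (by omega : k = l + 1)
    have hrs : r * s = 0 := by rw [hprod, hkl]; ring
    rw [hM, Polynomial.IsRoot.def]
    simp [hrs]
end

section
/- Let n ≥ 3 and let ω be an integer. The regular star configuration x = (2πω/n, …, 2πω/n) ∈ ℝ^{n-1} is a critical point of the signed area function f; it is a strict local maximum of f whenever 1 ≤ ω < n/2, and a strict local minimum of f whenever n/2 < ω ≤ n−1. -/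
open Filter Topology in
/-- If the scaled sine `ε * sin` lies strictly below its tangent line at `θ` on `(a, b) ∋ θ`, then
`ε` times the signed area has a strict local maximum at the constant configuration `θ`, where
`(m + 1) * θ` is a multiple of `2π`. -/
theorem eventually_signedArea_lt_of_tangent {m : ℕ} {ω : ℤ} {ε θ a b : ℝ}
    (hθ : ((m : ℝ) + 1) * θ = ω * (2 * Real.pi)) (haθ : a < θ) (hθb : θ < b)
    (htan : ∀ t, a < t → t < b → t ≠ θ →
      ε * Real.sin t < ε * (Real.sin θ + Real.cos θ * (t - θ))) :
    ∀ᶠ y in 𝓝[≠] (fun _ : Fin m => θ),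
      ε * ((∑ i, Real.sin (y i)) - Real.sin (∑ i, y i)) <
        ε * ((∑ _i : Fin m, Real.sin θ) - Real.sin (∑ _i : Fin m, θ)) := by
  have hle : ∀ t, a < t → t < b →
      ε * Real.sin t ≤ ε * (Real.sin θ + Real.cos θ * (t - θ)) := fun t ha hb => by
    rcases eq_or_ne t θ with rfl | h
    · simp
    · exact (htan t ha hb h).le
  have hsin : ∀ s, Real.sin s = -Real.sin (ω * (2 * Real.pi) - s) := fun s => by
    rw [Real.sin_int_mul_two_pi_sub, neg_neg]
  have hlast : ω * (2 * Real.pi) - ∑ _i : Fin m, θ = θ := by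
    simp only [Finset.sum_const, Finset.card_univ, Fintype.card_fin, nsmul_eq_mul]
    linarith
  have hcoord : ∀ᶠ y : Fin m → ℝ in 𝓝 (fun _ => θ), ∀ i, a < y i ∧ y i < b := by
    refine eventually_all.2 fun i => ?_
    have hi : Tendsto (fun y : Fin m → ℝ => y i) (𝓝 fun _ => θ) (𝓝 θ) :=
      (continuous_apply i).tendsto _
    exact (hi.eventually_const_lt haθ).and (hi.eventually_lt_const hθb)
  have hsum : ∀ᶠ y : Fin m → ℝ in 𝓝 (fun _ => θ),
      a < ω * (2 * Real.pi) - ∑ i, y i ∧ ω * (2 * Real.pi) - ∑ i, y i < b := by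
    have hc : Continuous fun y : Fin m → ℝ => ω * (2 * Real.pi) - ∑ i, y i := by fun_prop
    have ht := hc.tendsto fun _ => θ
    rw [hlast] at ht
    exact (ht.eventually_const_lt haθ).and (ht.eventually_lt_const hθb)
  filter_upwards [self_mem_nhdsWithin, hcoord.filter_mono nhdsWithin_le_nhds,
    hsum.filter_mono nhdsWithin_le_nhds] with y hne hy hs
  obtain ⟨j, hj⟩ := Function.ne_iff.1 hne
  have hlt : ∑ i, ε * Real.sin (y i) <
      ∑ i, ε * (Real.sin θ + Real.cos θ * (y i - θ)) :=
    Finset.sum_lt_sum (fun i _ => hle _ (hy i).1 (hy i).2)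
      ⟨j, Finset.mem_univ j, htan _ (hy j).1 (hy j).2 hj⟩
  have hl := hle _ hs.1 hs.2
  rw [hsin (∑ i, y i), hsin (∑ _i : Fin m, θ), hlast]
  simp only [← Finset.mul_sum, Finset.sum_add_distrib, Finset.sum_sub_distrib, Finset.sum_const,
    Finset.card_univ, Fintype.card_fin, nsmul_eq_mul] at hlt ⊢
  linear_combination hlt + hl - ε * Real.cos θ * hθ

theorem sin_lt_tangent {θ t : ℝ} (hθ₀ : 0 < θ) (hθπ : θ < Real.pi) (ht₀ : 0 < t)
    (htπ : t < Real.pi) (hne : t ≠ θ) :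
    Real.sin t < Real.sin θ + Real.cos θ * (t - θ) := by
  have hθ : θ ∈ Set.Icc 0 Real.pi := ⟨hθ₀.le, hθπ.le⟩
  have ht : t ∈ Set.Icc 0 Real.pi := ⟨ht₀.le, htπ.le⟩
  rcases hne.lt_or_gt with h | h
  · have := strictConcaveOn_sin_Icc.lt_slope_of_hasDerivAt ht hθ h (Real.hasDerivAt_sin θ)
    rw [slope_def_field, lt_div_iff₀ (sub_pos.2 h)] at this
    linarith
  · have := strictConcaveOn_sin_Icc.slope_lt_of_hasDerivAt hθ ht h (Real.hasDerivAt_sin θ)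
    rw [slope_def_field, div_lt_iff₀ (sub_pos.2 h)] at this
    linarith

theorem tangent_lt_sin {θ t : ℝ} (hθ₀ : Real.pi < θ) (hθπ : θ < 2 * Real.pi) (ht₀ : Real.pi < t)
    (htπ : t < 2 * Real.pi) (hne : t ≠ θ) :
    Real.sin θ + Real.cos θ * (t - θ) < Real.sin t := by
  have h := sin_lt_tangent (θ := 2 * Real.pi - θ) (t := 2 * Real.pi - t) (by linarith)
    (by linarith) (by linarith) (by linarith) (by simpa using hne)
  rw [Real.sin_two_pi_sub, Real.sin_two_pi_sub, Real.cos_two_pi_sub] at h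
  linarith

/-- The constant configuration `θ`, where `(m + 1) * θ` is a multiple of `2π`, is a critical point
of the signed area. -/
theorem hasFDerivAt_signedArea_const {m : ℕ} {ω : ℤ} {θ : ℝ}
    (hθ : ((m : ℝ) + 1) * θ = ω * (2 * Real.pi)) :
    HasFDerivAt (fun y : Fin m → ℝ => (∑ i, Real.sin (y i)) - Real.sin (∑ i, y i))
      (0 : (Fin m → ℝ) →L[ℝ] ℝ) (fun _ => θ) := by
  have hproj : ∀ i : Fin m, HasFDerivAt (fun y : Fin m → ℝ => y i)
      (ContinuousLinearMap.proj (R := ℝ) (φ := fun _ : Fin m => ℝ) i) (fun _ => θ) :=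
    fun i => hasFDerivAt_apply i _
  have hcos : Real.cos (∑ _i : Fin m, θ) = Real.cos θ := by
    rw [← Real.cos_int_mul_two_pi_sub θ ω, ← hθ]
    simp only [Finset.sum_const, Finset.card_univ, Fintype.card_fin, nsmul_eq_mul]
    ring_nf
  have h := (HasFDerivAt.fun_sum fun i (_ : i ∈ Finset.univ) => (hproj i).sin).sub
    (HasFDerivAt.fun_sum fun i (_ : i ∈ Finset.univ) => hproj i).sin
  refine h.congr_fderiv ?_
  rw [hcos, Finset.smul_sum, sub_self]


/-- The regular star `x = (2πω/n, …, 2πω/n)` is a critical point of the signed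
area function; it is a strict local maximum whenever `1 ≤ ω < n/2` and a strict
local minimum whenever `n/2 < ω ≤ n − 1`. -/
theorem regular_star_critical (n : ℕ) (hn : 3 ≤ n) (ω : ℤ) :
    let f : (Fin (n - 1) → ℝ) → ℝ :=
      fun y => (∑ i, Real.sin (y i)) - Real.sin (∑ i, y i)
    let x : Fin (n - 1) → ℝ := fun _ => 2 * Real.pi * (ω : ℝ) / (n : ℝ)
    fderiv ℝ f x = 0 ∧
    (1 ≤ ω → (ω : ℝ) < (n : ℝ) / 2 → ∀ᶠ y in nhdsWithin x {x}ᶜ, f y < f x) ∧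
    ((n : ℝ) / 2 < (ω : ℝ) → ω ≤ (n : ℤ) - 1 → ∀ᶠ y in nhdsWithin x {x}ᶜ, f x < f y) := by
  intro f x
  have hn₀ : (0 : ℝ) < n := by exact_mod_cast (by omega : 0 < n)
  have hθ : (((n - 1 : ℕ) : ℝ) + 1) * (2 * Real.pi * ω / n) = ω * (2 * Real.pi) := by
    rw [Nat.cast_sub (by omega)]
    field_simp
    push_cast
    ring
  refine ⟨(hasFDerivAt_signedArea_const hθ).fderiv, fun h₁ h₂ => ?_, fun h₁ h₂ => ?_⟩
  · have hω : (1 : ℝ) ≤ ω := by exact_mod_cast h₁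
    have hθ₀ : 0 < 2 * Real.pi * ω / n := by positivity
    have hθπ : 2 * Real.pi * ω / n < Real.pi := by
      rw [div_lt_iff₀ hn₀]
      nlinarith [Real.pi_pos]
    have h := eventually_signedArea_lt_of_tangent (ε := 1) hθ hθ₀ hθπ
      fun t ht₀ htπ hne => by simpa using sin_lt_tangent hθ₀ hθπ ht₀ htπ hne
    simpa only [one_mul] using h
  · have hω : (ω : ℝ) ≤ n - 1 := by exact_mod_cast h₂
    have hθ₀ : Real.pi < 2 * Real.pi * ω / n := by
      rw [lt_div_iff₀ hn₀]
      nlinarith [Real.pi_pos]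
    have hθπ : 2 * Real.pi * ω / n < 2 * Real.pi := by
      rw [div_lt_iff₀ hn₀]
      nlinarith [Real.pi_pos]
    have h := eventually_signedArea_lt_of_tangent (ε := -1) hθ hθ₀ hθπ
      fun t ht₀ htπ hne => by linarith [tangent_lt_sin hθ₀ hθπ ht₀ htπ hne]
    simpa only [neg_one_mul, neg_lt_neg_iff] using h
end

section
/- Let n ≥ 3, let b be an integer with 0 ≤ b ≤ n and n ≠ 2b, let ω ∈ ℤ, and set θ = 2πω/(n − 2b). Let ε_1, …, ε_n ∈ {+1, −1} with exactly b of the ε_i equal to −1. Then the point x = (ε_1 θ, …, ε_{n-1} θ) ∈ ℝ^{n-1} is a critical point of the signed area function f, and the critical value is f(x) = (n − 2b)·sin(2πω/(n − 2b)). -/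
/-- The signed area has the differential `∑ cos(x_i) dx_i − cos(∑ x_i) ∑ dx_i`. -/
theorem hasFDerivAt_signedArea {ι : Type*} [Fintype ι] (x : ι → ℝ) :
    HasFDerivAt (fun y : ι → ℝ => (∑ i, Real.sin (y i)) - Real.sin (∑ i, y i))
      ((∑ i, Real.cos (x i) • ContinuousLinearMap.proj (R := ℝ) (φ := fun _ : ι => ℝ) i) -
        Real.cos (∑ i, x i) •
          ∑ i, ContinuousLinearMap.proj (R := ℝ) (φ := fun _ : ι => ℝ) i) x :=
  (HasFDerivAt.fun_sum fun i _ => (hasFDerivAt_apply i x).sin).sub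
    (HasFDerivAt.fun_sum fun i _ => hasFDerivAt_apply i x).sin

/-- A point all of whose central angles, including the last one, have the same cosine is a
critical point of the signed area. -/
theorem fderiv_signedArea_eq_zero {ι : Type*} [Fintype ι] (x : ι → ℝ)
    (h : ∀ i, Real.cos (x i) = Real.cos (∑ j, x j)) :
    fderiv ℝ (fun y : ι → ℝ => (∑ i, Real.sin (y i)) - Real.sin (∑ i, y i)) x = 0 := by
  simp only [(hasFDerivAt_signedArea x).fderiv, h, ← Finset.smul_sum, sub_self]

/-- A family of signs, `b` of which are negative, sums to the number of its terms minus `2b`. -/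
theorem sum_signs {ι : Type*} [Fintype ι] {ε : ι → ℝ} (hε : ∀ i, ε i = 1 ∨ ε i = -1) :
    ∑ i, ε i =
      (Fintype.card ι : ℝ) - 2 * ((Finset.univ.filter fun i => ε i = -1).card : ℝ) := by
  have h : ∀ i, ε i = 1 - 2 * (if ε i = -1 then 1 else 0) := by
    intro i
    rcases hε i with h | h <;> norm_num [h]
  rw [Finset.sum_congr rfl fun i _ => h i, Finset.sum_sub_distrib, ← Finset.mul_sum,
    Finset.sum_boole]
  simp

theorem sin_sign_mul {e : ℝ} (he : e = 1 ∨ e = -1) (t : ℝ) :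
    Real.sin (e * t) = e * Real.sin t := by
  rcases he with rfl | rfl <;> simp

theorem cos_sign_mul {e : ℝ} (he : e = 1 ∨ e = -1) (t : ℝ) :
    Real.cos (e * t) = Real.cos t := by
  rcases he with rfl | rfl <;> simp

/-- Regular and zigzag stars: with `θ = 2πω/(n − 2b)` and signs `ε_i ∈ {±1}`,
exactly `b` of which are `−1`, the point `x = (ε_1 θ, …, ε_{n-1} θ)` is a critical
point of the signed area function with critical value `(n − 2b)·sin(2πω/(n − 2b))`. -/
theorem star_critical_value (n b : ℕ) (hn : 3 ≤ n) (hb : b ≤ n) (hnb : n ≠ 2 * b)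
    (ω : ℤ) (ε : Fin n → ℝ) (hε : ∀ i, ε i = 1 ∨ ε i = -1)
    (hcard : (Finset.univ.filter fun i => ε i = -1).card = b) :
    let θ : ℝ := 2 * Real.pi * (ω : ℝ) / ((n : ℝ) - 2 * (b : ℝ))
    let f : (Fin (n - 1) → ℝ) → ℝ :=
      fun y => (∑ i, Real.sin (y i)) - Real.sin (∑ i, y i)
    let x : Fin (n - 1) → ℝ := fun i => ε (Fin.castLE (Nat.sub_le n 1) i) * θ
    fderiv ℝ f x = 0 ∧
    f x = ((n : ℝ) - 2 * (b : ℝ)) * Real.sin (2 * Real.pi * (ω : ℝ) / ((n : ℝ) - 2 * (b : ℝ))) := by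
  intro θ f x
  obtain ⟨m, rfl⟩ : ∃ m, n = m + 1 := ⟨n - 1, by omega⟩
  have hne : ((m + 1 : ℕ) : ℝ) - 2 * (b : ℝ) ≠ 0 := sub_ne_zero.mpr (mod_cast hnb)
  have hsum : ∑ i : Fin m, ε i.castSucc + ε (Fin.last m) = ((m + 1 : ℕ) : ℝ) - 2 * (b : ℝ) := by
    rw [← Fin.sum_univ_castSucc, sum_signs hε, hcard, Fintype.card_fin]
  have hx : ∑ i, x i = ω * (2 * Real.pi) - ε (Fin.last m) * θ := by
    have hθ : (((m + 1 : ℕ) : ℝ) - 2 * (b : ℝ)) * θ = 2 * Real.pi * ω := mul_div_cancel₀ _ hne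
    have hxε : ∑ i, x i = (∑ i : Fin m, ε i.castSucc) * θ := (Finset.sum_mul _ _ _).symm
    rw [hxε, eq_sub_of_add_eq hsum, sub_mul, hθ]
    ring
  refine ⟨fderiv_signedArea_eq_zero x fun i => ?_, ?_⟩
  · rw [hx, Real.cos_int_mul_two_pi_sub, cos_sign_mul (hε _), cos_sign_mul (hε _)]
  · have hsin : ∑ i, Real.sin (x i) = (∑ i : Fin m, ε i.castSucc) * Real.sin θ := by
      rw [Finset.sum_mul]
      exact Finset.sum_congr rfl fun i _ => sin_sign_mul (hε _) θ
    change (∑ i, Real.sin (x i)) - Real.sin (∑ i, x i) = _ * Real.sin θ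
    rw [hx, Real.sin_int_mul_two_pi_sub, hsin, sin_sign_mul (hε _), ← hsum]
    ring
end

section
/- Let N ≥ 2 be an even integer and let J be the ideal of ℂ[X_1, …, X_N] generated by the N polynomials X_p² − (X_1 + ⋯ + X_N)², p = 1, …, N. Then the quotient ring ℂ[X_1, …, X_N]/J is a finite-dimensional ℂ-vector space of dimension 2^N. -/
open MvPolynomial

section QuotientDimension

variable {K V : Type*} [Field K] [AddCommGroup V] [Module K V]

theorem Submodule.rank_quotient_add_rank_map_mkQ {A B : Submodule K V} (h : A ≤ B) :
    Module.rank K (V ⧸ B) + Module.rank K (B.map A.mkQ) = Module.rank K (V ⧸ A) := by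
  rw [← (Submodule.quotientQuotientEquivQuotient A B h).rank_eq]
  exact Submodule.rank_quotient_add_rank _

/-- An injective endomorphism stabilizing a subspace of finite codimension has the same
cokernel dimension on the subspace as on the whole space. -/
theorem LinearMap.rank_map_mkQ_map_eq_rank_quotient_range (f : V →ₗ[K] V)
    (hf : Function.Injective f) (L : Submodule K V) (hL : L.map f ≤ L)
    [FiniteDimensional K (V ⧸ L)] :
    Module.rank K (L.map (L.map f).mkQ) = Module.rank K (V ⧸ LinearMap.range f) := by
  have h₁ := Submodule.rank_quotient_add_rank_map_mkQ hL
  have h₂ := Submodule.rank_quotient_add_rank_map_mkQ (LinearMap.map_le_range (f := f) (p := L))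
  have h₃ : Module.rank K ((LinearMap.range f).map (L.map f).mkQ) = Module.rank K (V ⧸ L) := by
    have hker : LinearMap.ker ((L.map f).mkQ ∘ₗ f) = L := by
      rw [LinearMap.ker_comp, Submodule.ker_mkQ, Submodule.comap_map_eq_of_injective hf]
    have e := ((L.map f).mkQ ∘ₗ f).quotKerEquivRange
    rw [hker, LinearMap.range_comp] at e
    exact e.rank_eq.symm
  rw [h₃, ← h₁, add_comm] at h₂
  exact (Cardinal.eq_of_add_eq_add_left h₂ (Module.rank_lt_aleph0 K (V ⧸ L))).symm

end QuotientDimension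

theorem sum_units_int_ne_one {N : ℕ} (hN : Even N) (ε : Fin N → ℤˣ) :
    ∑ i, (ε i : ℤ) ≠ 1 := by
  intro h
  have h' := congrArg (Int.cast : ℤ → ZMod 2) h
  have hε : ∀ u : ℤˣ, ((u : ℤ) : ZMod 2) = 1 := by
    intro u
    rcases Int.units_eq_one_or u with rfl | rfl <;> decide
  have h2 : (N : ZMod 2) = 0 := (ZMod.natCast_eq_zero_iff_even).2 hN
  simp [hε, h2] at h'

section SignEval

variable (N : ℕ)

/-- Evaluation at the points `(±t, …, ±t)`, where `t` is the polynomial variable. -/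
noncomputable def signEval :
    MvPolynomial (Fin N) (Polynomial ℂ) →ₐ[ℂ] ((Fin N → ℤˣ) → Polynomial ℂ) :=
  AlgHom.pi fun ε =>
    (aeval fun i => ((ε i : ℤ) : Polynomial ℂ) * Polynomial.X).restrictScalars ℂ

/-- The substitution `t ↦ X_1 + ⋯ + X_N`. -/
noncomputable def substSum :
    MvPolynomial (Fin N) (Polynomial ℂ) →ₐ[ℂ] MvPolynomial (Fin N) ℂ :=
  { eval₂Hom (Polynomial.aeval (∑ i, X i : MvPolynomial (Fin N) ℂ)).toRingHom X with
    commutes' := fun r => by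
      simp [IsScalarTower.algebraMap_apply ℂ (Polynomial ℂ) (MvPolynomial (Fin N) (Polynomial ℂ)),
        MvPolynomial.algebraMap_eq] }

/-- The inclusion of constant-coefficient polynomials. -/
noncomputable def constMap :
    MvPolynomial (Fin N) ℂ →ₐ[ℂ] MvPolynomial (Fin N) (Polynomial ℂ) :=
  aeval X

variable {N}

@[simp] theorem signEval_X (ε : Fin N → ℤˣ) (i : Fin N) :
    signEval N (X i) ε = ((ε i : ℤ) : Polynomial ℂ) * Polynomial.X := by
  simp [signEval]

@[simp] theorem signEval_C (ε : Fin N → ℤˣ) (p : Polynomial ℂ) :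
    signEval N (C p) ε = p := by
  simp [signEval]

@[simp] theorem substSum_X (i : Fin N) : substSum N (X i) = X i := by
  simp [substSum]

@[simp] theorem substSum_C (p : Polynomial ℂ) :
    substSum N (C p) = Polynomial.aeval (∑ i, X i) p := by
  simp [substSum]

@[simp] theorem constMap_X (i : Fin N) : constMap N (X i) = X i := by
  simp [constMap]

theorem substSum_constMap (f : MvPolynomial (Fin N) ℂ) : substSum N (constMap N f) = f := by
  have : (substSum N).comp (constMap N) = AlgHom.id ℂ _ := by
    ext i; simp
  exact DFunLike.congr_fun this f

theorem sub_constMap_substSum_mem (g : MvPolynomial (Fin N) (Polynomial ℂ)) :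
    g - constMap N (substSum N g) ∈
      Ideal.span {∑ i, X i - C Polynomial.X} := by
  rw [← Ideal.Quotient.mk_eq_mk_iff_sub_mem]
  set q := Ideal.Quotient.mk (Ideal.span {∑ i, X i - C (σ := Fin N) (Polynomial.X (R := ℂ))})
  have : q = (q.comp (constMap N).toRingHom).comp (substSum N).toRingHom := by
    refine MvPolynomial.ringHom_ext' (Polynomial.ringHom_ext ?_ ?_) ?_
    · intro a
      have h : (C (Polynomial.C a) : MvPolynomial (Fin N) (Polynomial ℂ)) = algebraMap ℂ _ a := rfl
      change q (C (Polynomial.C a)) = q (constMap N (substSum N (C (Polynomial.C a))))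
      rw [h, AlgHom.commutes, AlgHom.commutes]
    · change q (C Polynomial.X) = q (constMap N (substSum N (C Polynomial.X)))
      rw [substSum_C, Polynomial.aeval_X, map_sum, eq_comm, Ideal.Quotient.mk_eq_mk_iff_sub_mem]
      simp only [constMap_X]
      exact Ideal.subset_span rfl
    · intro i
      change q (X i) = q (constMap N (substSum N (X i)))
      rw [substSum_X, constMap_X]
  exact DFunLike.congr_fun this g

theorem signEval_eq_zero {f : MvPolynomial (Fin N) (Polynomial ℂ)} (hf : signEval N f = 0) :
    f ∈ Ideal.span (Set.range fun i : Fin N => X i ^ 2 - C (Polynomial.X (R := ℂ)) ^ 2) := by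
  classical
  obtain ⟨h, -, hh⟩ := combinatorial_nullstellensatz_exists_linearCombination
    (fun _ : Fin N => ({Polynomial.X, -Polynomial.X} : Finset (Polynomial ℂ)))
    (fun _ => by simp) f (by
      intro x hx
      have hx' : ∀ i, ∃ u : ℤˣ, x i = ((u : ℤ) : Polynomial ℂ) * Polynomial.X := by
        intro i
        rcases Finset.mem_insert.1 (hx i) with h | h
        · exact ⟨1, by simpa using h⟩
        · exact ⟨-1, by simpa using h⟩
      choose ε hε using hx'
      have := congrFun hf ε
      rw [funext hε]
      simpa [signEval, aeval_eq_eval] using this)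
  have hne : (Polynomial.X : Polynomial ℂ) ≠ -Polynomial.X := by
    intro h
    have := congrArg (Polynomial.eval 1) h
    norm_num at this
  rw [hh, Finsupp.linearCombination_apply]
  refine Ideal.sum_mem _ fun i _ => ?_
  refine Ideal.mul_mem_left _ _ (Ideal.subset_span ⟨i, ?_⟩)
  rw [Finset.prod_pair hne, map_neg]
  ring

/-- Multiplication by the values of `X_1 + ⋯ + X_N - t`. -/
noncomputable def mulDiff (N : ℕ) :
    ((Fin N → ℤˣ) → Polynomial ℂ) →ₗ[ℂ] ((Fin N → ℤˣ) → Polynomial ℂ) :=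
  LinearMap.mulLeft ℂ (signEval N (∑ i, X i - C Polynomial.X))

theorem mulDiff_apply (v : (Fin N → ℤˣ) → Polynomial ℂ) (ε : Fin N → ℤˣ) :
    mulDiff N v ε =
      Polynomial.C (((∑ i, (ε i : ℤ) - 1 : ℤ)) : ℂ) * Polynomial.X * v ε := by
  simp [mulDiff, ← Finset.sum_mul, sub_mul]

theorem signCoeff_ne_zero (hN : Even N) (ε : Fin N → ℤˣ) :
    (((∑ i, (ε i : ℤ) - 1 : ℤ)) : ℂ) ≠ 0 :=
  Int.cast_ne_zero.2 (sub_ne_zero.2 (sum_units_int_ne_one hN ε))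

theorem mulDiff_injective (hN : Even N) : Function.Injective (mulDiff N) := by
  rw [← LinearMap.ker_eq_bot, LinearMap.ker_eq_bot']
  intro v hv
  ext1 ε
  have := congrFun hv ε
  rw [mulDiff_apply] at this
  have hc := signCoeff_ne_zero hN ε
  simpa [-Int.cast_sub, -Int.cast_sum, -map_intCast, Polynomial.C_eq_zero, hc] using this

theorem rank_quotient_range_mulDiff (hN : Even N) :
    Module.rank ℂ (((Fin N → ℤˣ) → Polynomial ℂ) ⧸ LinearMap.range (mulDiff N)) =
      (2 ^ N : ℕ) := by
  let e : ((Fin N → ℤˣ) → Polynomial ℂ) →ₗ[ℂ] ((Fin N → ℤˣ) → ℂ) :=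
    LinearMap.pi fun ε => Polynomial.lcoeff ℂ 0 ∘ₗ LinearMap.proj ε
  have he : Function.Surjective e := fun w => ⟨fun ε => Polynomial.C (w ε), by ext; simp [e]⟩
  have hker : LinearMap.ker e = LinearMap.range (mulDiff N) := by
    ext v
    constructor
    · intro hv
      have hX : ∀ ε, Polynomial.X ∣ v ε := fun ε => Polynomial.X_dvd_iff.2 (congrFun hv ε)
      choose w hw using hX
      refine ⟨fun ε => Polynomial.C (((∑ i, (ε i : ℤ) - 1 : ℤ)) : ℂ)⁻¹ * w ε, ?_⟩
      ext1 ε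
      have hc := signCoeff_ne_zero hN ε
      rw [mulDiff_apply, hw ε]
      generalize (((∑ i, (ε i : ℤ) - 1 : ℤ)) : ℂ) = c at hc
      have : Polynomial.C c * Polynomial.C c⁻¹ = 1 := by
        rw [← Polynomial.C_mul, mul_inv_cancel₀ hc, Polynomial.C_1]
      linear_combination Polynomial.X * w ε * this
    · rintro ⟨w, rfl⟩
      ext ε
      simp only [e, LinearMap.pi_apply, LinearMap.comp_apply, LinearMap.proj_apply,
        mulDiff_apply, Polynomial.lcoeff_apply, Polynomial.mul_coeff_zero]
      simp
  have := (e.quotKerEquivOfSurjective he).rank_eq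
  rw [hker] at this
  rw [this]
  simp

/-- The image of evaluation at the sign points. -/
noncomputable def signRange (N : ℕ) : Submodule ℂ ((Fin N → ℤˣ) → Polynomial ℂ) :=
  LinearMap.range (signEval N).toLinearMap

theorem X_pow_mul_mem_signRange (v : (Fin N → ℤˣ) → Polynomial ℂ) :
    (fun ε => Polynomial.X ^ N * v ε) ∈ signRange N := by
  refine ⟨∑ δ : Fin N → ℤˣ, C (Polynomial.C ((2 ^ N)⁻¹) * v δ) *
    ∏ i, (C Polynomial.X + C ((δ i : ℤ) : Polynomial ℂ) * X i), ?_⟩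
  ext1 ε
  have hprod : ∀ δ : Fin N → ℤˣ, ∏ i, (Polynomial.X + ((δ i : ℤ) : Polynomial ℂ) *
      (((ε i : ℤ) : Polynomial ℂ) * Polynomial.X)) =
      if δ = ε then Polynomial.C (2 ^ N) * Polynomial.X ^ N else 0 := by
    intro δ
    split_ifs with h
    · subst h
      have : ∀ i, (Polynomial.X + ((δ i : ℤ) : Polynomial ℂ) *
          (((δ i : ℤ) : Polynomial ℂ) * Polynomial.X)) = Polynomial.C 2 * Polynomial.X := by
        intro i
        rcases Int.units_eq_one_or (δ i) with h | h <;> 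
          simp [h, map_ofNat Polynomial.C] <;> ring
      simp only [this, Finset.prod_const, Finset.card_univ, Fintype.card_fin, mul_pow, map_pow]
    · obtain ⟨i, hi⟩ := Function.ne_iff.1 h
      refine Finset.prod_eq_zero (Finset.mem_univ i) ?_
      rcases Int.units_eq_one_or (δ i) with h | h <;>
        rcases Int.units_eq_one_or (ε i) with h' | h' <;> simp_all
  simp only [AlgHom.toLinearMap_apply, map_sum, map_mul, map_prod, map_add, Finset.sum_apply,
    Pi.mul_apply, Finset.prod_apply, Pi.add_apply, signEval_C, signEval_X, hprod]
  have h2 : Polynomial.C ((2 : ℂ) ^ N)⁻¹ * Polynomial.C (2 ^ N) = 1 := by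
    rw [← Polynomial.C_mul, inv_mul_cancel₀ (pow_ne_zero N two_ne_zero), Polynomial.C_1]
  simp only [mul_ite, mul_zero, Finset.sum_ite_eq', Finset.mem_univ, if_true]
  linear_combination Polynomial.X ^ N * v ε * h2

instance finiteDimensional_quotient_signRange :
    FiniteDimensional ℂ (((Fin N → ℤˣ) → Polynomial ℂ) ⧸ signRange N) := by
  let r : ((Fin N → ℤˣ) → Polynomial.degreeLT ℂ N) →ₗ[ℂ]
      (((Fin N → ℤˣ) → Polynomial ℂ) ⧸ signRange N) :=
    (signRange N).mkQ ∘ₗ LinearMap.pi fun ε => (Polynomial.degreeLT ℂ N).subtype ∘ₗ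
      LinearMap.proj ε
  refine Module.Finite.of_surjective r ?_
  intro y
  obtain ⟨v, rfl⟩ := (signRange N).mkQ_surjective y
  have hm : (Polynomial.X ^ N : Polynomial ℂ).Monic := Polynomial.monic_X_pow N
  refine ⟨fun ε => ⟨v ε %ₘ Polynomial.X ^ N, ?_⟩, ?_⟩
  · rw [Polynomial.mem_degreeLT]
    simpa using Polynomial.degree_modByMonic_lt (v ε) hm
  · refine (Submodule.Quotient.eq _).2 ?_
    convert X_pow_mul_mem_signRange (fun ε => -(v ε /ₘ Polynomial.X ^ N)) using 1
    ext1 ε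
    have := Polynomial.modByMonic_add_div (v ε) (Polynomial.X ^ N)
    simp only [Pi.sub_apply, LinearMap.pi_apply, LinearMap.comp_apply, LinearMap.proj_apply,
      Submodule.subtype_apply]
    linear_combination this

end SignEval

/-- The Milnor algebra `ℂ[X_1,…,X_N]/J`, where `J` is generated by the polynomials
`X_p² − (X_1 + ⋯ + X_N)²`, is a finite-dimensional `ℂ`-vector space of dimension `2^N`. -/
theorem milnor_number_degenerate_star (N : ℕ) (hN : 2 ≤ N) (hNe : Even N) :
    let J : Ideal (MvPolynomial (Fin N) ℂ) :=
      Ideal.span (Set.range fun q : Fin N => (X q) ^ 2 - (∑ i, X i) ^ 2)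
    FiniteDimensional ℂ (MvPolynomial (Fin N) ℂ ⧸ J) ∧
      Module.finrank ℂ (MvPolynomial (Fin N) ℂ ⧸ J) = 2 ^ N := by
  intro J
  set A := (signRange N).map (mulDiff N)
  have hA : A ≤ signRange N := by
    rintro _ ⟨_, ⟨g, rfl⟩, rfl⟩
    exact ⟨(∑ i, X i - C Polynomial.X) * g, by simp only [AlgHom.toLinearMap_apply, map_mul]; rfl⟩
  let φ : MvPolynomial (Fin N) ℂ →ₗ[ℂ] (((Fin N → ℤˣ) → Polynomial ℂ) ⧸ A) :=
    A.mkQ ∘ₗ (signEval N).toLinearMap ∘ₗ (constMap N).toLinearMap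
  have hker : LinearMap.ker φ = J.restrictScalars ℂ := by
    ext f
    constructor
    · intro hf
      obtain ⟨_, ⟨g, rfl⟩, hg⟩ := (Submodule.Quotient.mk_eq_zero A).1 hf
      have h0 : signEval N (constMap N f - (∑ i, X i - C Polynomial.X) * g) = 0 := by
        rw [map_sub, map_mul, sub_eq_zero]
        exact hg.symm
      have h1 := Ideal.mem_map_of_mem (substSum N) (signEval_eq_zero h0)
      rw [Ideal.map_span, ← Set.range_comp] at h1
      simpa [substSum_constMap, Function.comp_def] using h1
    · intro hf
      suffices h : ∃ g, signEval N (constMap N f) =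
          signEval N ((∑ i, X i - C Polynomial.X) * g) by
        obtain ⟨g, hg⟩ := h
        refine (Submodule.Quotient.mk_eq_zero A).2 ⟨_, ⟨g, rfl⟩, ?_⟩
        rw [map_mul] at hg
        exact hg.symm
      have hf' : f ∈ J := hf
      induction hf' using Submodule.span_induction with
      | mem x hx =>
        obtain ⟨q, rfl⟩ := hx
        refine ⟨-(∑ i, X i + C Polynomial.X), ?_⟩
        ext1 ε
        have hsq : ((ε q : ℤ) : Polynomial ℂ) ^ 2 = 1 := by
          rcases Int.units_eq_one_or (ε q) with h | h <;> simp [h]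
        simp only [map_sub, map_pow, map_sum, constMap_X, map_mul, map_neg, map_add,
          Pi.sub_apply, Pi.pow_apply, Pi.mul_apply, Pi.neg_apply, Pi.add_apply,
          Finset.sum_apply, signEval_X, signEval_C]
        linear_combination Polynomial.X ^ 2 * hsq
      | zero => exact ⟨0, by simp⟩
      | add x y hx hy ihx ihy =>
        obtain ⟨g, hg⟩ := ihx hx
        obtain ⟨g', hg'⟩ := ihy hy
        exact ⟨g + g', by rw [map_add, map_add, hg, hg', mul_add, map_add]⟩
      | smul a x hx ih =>
        obtain ⟨g, hg⟩ := ih hx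
        refine ⟨constMap N a * g, ?_⟩
        rw [smul_eq_mul, map_mul, map_mul, hg, ← map_mul]
        ring_nf
  have hrange : LinearMap.range φ = (signRange N).map A.mkQ := by
    refine le_antisymm ?_ ?_
    · rintro _ ⟨f, rfl⟩
      exact ⟨_, ⟨constMap N f, rfl⟩, rfl⟩
    · rintro _ ⟨_, ⟨g, rfl⟩, rfl⟩
      refine ⟨substSum N g, Eq.symm ((Submodule.Quotient.eq A).2 ?_)⟩
      obtain ⟨h, hh⟩ := Ideal.mem_span_singleton.1 (sub_constMap_substSum_mem g)
      refine ⟨signEval N h, ⟨h, rfl⟩, ?_⟩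
      have := congrArg (signEval N) hh
      rw [map_sub, map_mul] at this
      exact this.symm
  have hrank : Module.rank ℂ (MvPolynomial (Fin N) ℂ ⧸ J) = (2 ^ N : ℕ) := by
    have e := φ.quotKerEquivRange
    rw [hker, hrange] at e
    have h := LinearMap.rank_map_mkQ_map_eq_rank_quotient_range (mulDiff N)
      (mulDiff_injective hNe) (signRange N) hA
    rw [rank_quotient_range_mulDiff hNe] at h
    exact e.rank_eq.trans h
  refine ⟨?_, Module.finrank_eq_of_rank_eq hrank⟩
  rw [FiniteDimensional, ← Module.rank_lt_aleph0_iff, hrank]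
  exact Cardinal.natCast_lt_aleph0
end

section
/- Let m ≥ 1 and let w_0, w_1, …, w_m be real numbers satisfying, for each p = 0, 1, …, m−1 (with the first term absent when p = 0): 2p(2p−1)·w_{p−1} + (2m − 1 + 4p(2m − 2p))·w_p + (2m − 2p)(2m − 2p − 1)·w_{p+1} = 0. Then for every p = 1, …, m one has (2p − 1)·w_{p−1} = −(2m + 2 − 2p)·w_p; in particular the solution space of the three-term relations is one-dimensional. -/
/-- The three-term relations
`2p(2p−1)·w_{p−1} + (2m−1+4p(2m−2p))·w_p + (2m−2p)(2m−2p−1)·w_{p+1} = 0`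
(for `0 ≤ p ≤ m−1`; the first term is absent when `p = 0` since its coefficient vanishes)
imply the two-term recurrence `(2p−1)·w_{p−1} = −(2m+2−2p)·w_p` for `1 ≤ p ≤ m`;
in particular the solution space is one-dimensional. -/
theorem three_term_to_two_term (m : ℕ) (hm : 1 ≤ m) (w : ℕ → ℝ)
    (hrec : ∀ p < m,
      (2 * (p : ℝ)) * (2 * (p : ℝ) - 1) * w (p - 1)
        + (2 * (m : ℝ) - 1 + 4 * (p : ℝ) * (2 * (m : ℝ) - 2 * (p : ℝ))) * w p
        + (2 * (m : ℝ) - 2 * (p : ℝ)) * (2 * (m : ℝ) - 2 * (p : ℝ) - 1) * w (p + 1) = 0) :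
    ∀ p, 1 ≤ p → p ≤ m →
      (2 * (p : ℝ) - 1) * w (p - 1) = -(2 * (m : ℝ) + 2 - 2 * (p : ℝ)) * w p := by
  intro p hp
  induction p, hp using Nat.le_induction with
  | base =>
    intro _
    have hm' : (1 : ℝ) ≤ m := by exact_mod_cast hm
    have h := hrec 0 hm
    push_cast at h ⊢
    apply mul_left_cancel₀ (show 2 * (m : ℝ) - 1 ≠ 0 by linarith)
    linear_combination h
  | succ p hp ih =>
    intro hpm
    have hpm' : (p : ℝ) + 1 ≤ m := by exact_mod_cast hpm
    have h := hrec p hpm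
    have h_prev := ih (by lia)
    rw [Nat.add_sub_cancel]
    push_cast
    apply mul_left_cancel₀ (show 2 * (m : ℝ) - 2 * p - 1 ≠ 0 by linarith)
    linear_combination h - 2 * (p : ℝ) * h_prev
end

section
/- Let m ≥ 1, set b_p = (−1)^p · (2p)!! · (2m − 2p − 1)!! / (2m − 1)!! for p = 0, …, m, and let M be the symmetric real matrix indexed by the m-element subsets σ, τ of a 2m-element set with entries M_{σ,τ} = b_{|σ∩τ|}. Then M is positive definite if m is even and negative definite if m is odd; in particular its signature is (−1)^m · C(2m, m). -/
section

open Finset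

theorem doubleFactorial_two_mul_add_one (r : ℕ) : ((2 * r + 1).doubleFactorial : ℝ) =
    (2 * r + 1) * (2 * r - 1).doubleFactorial := by
  cases r with
  | zero => simp
  | succ r =>
    rw [show 2 * (r + 1) + 1 = (2 * r + 1) + 2 by ring, Nat.doubleFactorial_add_two,
      show 2 * (r + 1) - 1 = 2 * r + 1 by lia]
    push_cast
    ring

theorem sum_antidiagonal_choose_mul_inv_odd (p q : ℕ) :
    ∑ x ∈ antidiagonal (p + q), (p.choose x.1 : ℝ) * ((-1) ^ x.2 / (2 * x.2 + 1)) =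
      (-1) ^ q * (2 * p).doubleFactorial * (2 * q - 1).doubleFactorial /
        (2 * (p + q) + 1).doubleFactorial := by
  induction p generalizing q with
  | zero =>
    rw [zero_add, Finset.sum_eq_single (0, q)]
    · have h : ((2 * q - 1).doubleFactorial : ℝ) ≠ 0 := by
        exact_mod_cast (Nat.doubleFactorial_pos _).ne'
      have h' : (2 * q + 1 : ℝ) ≠ 0 := by positivity
      rw [doubleFactorial_two_mul_add_one]
      simp
      field_simp
    · rintro ⟨i, u⟩ h hne
      rcases i with - | i
      · simp_all
      · simp
    · simp
  | succ p ih =>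
    have h₁ := ih q
    have h₂ := ih (q + 1)
    rw [show p + 1 + q = (p + q) + 1 by ring]
    rw [show p + (q + 1) = (p + q) + 1 by ring] at h₂
    rw [Finset.Nat.sum_antidiagonal_succ] at h₂ ⊢
    simp only [Nat.choose_succ_succ, Nat.cast_add, add_mul, sum_add_distrib] at h₂ ⊢
    have e : ((2 * (p + q + 1) + 1).doubleFactorial : ℝ) =
        (2 * (p + q) + 3) * (2 * (p + q) + 1).doubleFactorial := by
      rw [doubleFactorial_two_mul_add_one, show 2 * (p + q + 1) - 1 = 2 * (p + q) + 1 by lia]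
      push_cast
      ring
    have e' : ((2 * (p + 1)).doubleFactorial : ℝ) = (2 * p + 2) * (2 * p).doubleFactorial := by
      rw [show 2 * (p + 1) = 2 * p + 2 by ring, Nat.doubleFactorial_add_two]
      push_cast
      ring
    rw [show 2 * (q + 1) - 1 = 2 * q + 1 by lia, doubleFactorial_two_mul_add_one, e] at h₂
    rw [e, e', h₁]
    simp only [Nat.choose_zero_right] at h₂ ⊢
    have h : ((2 * (p + q) + 1).doubleFactorial : ℝ) ≠ 0 := by
      exact_mod_cast (Nat.doubleFactorial_pos _).ne'
    have h' : (2 * (p + q) + 3 : ℝ) ≠ 0 := by positivity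
    rw [add_left_comm, h₂]
    field_simp
    ring

theorem sum_choose_mul_choose_mul_inv_odd (n N : ℕ) (hN : n < N) :
    ∑ u ∈ range N, (n.choose u : ℝ) * (n + u).choose u * ((-1) ^ u / (2 * u + 1)) =
      1 / (2 * n + 1) := by
  induction n with
  | zero =>
    rw [Finset.sum_eq_single 0]
    · simp
    · intro u _ hu
      simp [Nat.choose_eq_zero_of_lt (Nat.pos_of_ne_zero hu)]
    · simp; lia
  | succ n ih =>
    have ih := ih (by lia)
    let G : ℕ → ℝ := fun u =>
      -2 * u ^ 2 / (n + 1) ^ 2 * ((-1) ^ u * (n + 1).choose u * (n + u).choose u)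
    have key (u : ℕ) : (2 * n + 3) * (((n + 1).choose u : ℝ) * (n + 1 + u).choose u *
          ((-1) ^ u / (2 * u + 1))) -
        (2 * n + 1) * ((n.choose u : ℝ) * (n + u).choose u * ((-1) ^ u / (2 * u + 1))) =
        G (u + 1) - G u := by
      have h₁ : ((n + 1 + u).choose u : ℝ) = (n + 1 + u) / (n + 1) * (n + u).choose u := by
        have := Nat.choose_mul_succ_eq (n + u) u
        rw [show n + u + 1 - u = n + 1 by lia, show n + u + 1 = n + 1 + u by ring] at this
        have : ((n + u).choose u : ℝ) * (n + 1 + u) = (n + 1 + u).choose u * (n + 1) := by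
          exact_mod_cast this
        field_simp
        linarith
      have h₂ : (n.choose u : ℝ) = (n + 1 - u) / (n + 1) * (n + 1).choose u := by
        rcases le_or_gt u (n + 1) with hu | hu
        · have := Nat.choose_mul_succ_eq n u
          have : (n.choose u : ℝ) * (n + 1) = (n + 1).choose u * (n + 1 - u) := by
            have h := congrArg (Nat.cast : ℕ → ℝ) this
            push_cast [Nat.cast_sub hu] at h
            exact h
          field_simp
          linarith
        · rw [Nat.choose_eq_zero_of_lt hu, Nat.choose_eq_zero_of_lt (by lia)]
          simp
      have h₃ : ((n + 1).choose (u + 1) : ℝ) = (n + 1 - u) / (u + 1) * (n + 1).choose u := by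
        have : ((n + 1).choose (u + 1) : ℝ) * (u + 1) = (n + 1).choose u * (n + 1 - u) := by
          have h := Nat.add_one_mul_choose_eq n u
          have h : ((n : ℝ) + 1) * n.choose u = (n + 1).choose (u + 1) * (u + 1) := by
            exact_mod_cast h
          rw [← h, h₂]
          field_simp
        field_simp
        linarith
      have h₄ : ((n + (u + 1)).choose (u + 1) : ℝ) =
          (n + u + 1) / (u + 1) * (n + u).choose u := by
        have h := Nat.add_one_mul_choose_eq (n + u) u
        have h : ((n : ℝ) + u + 1) * (n + u).choose u = (n + (u + 1)).choose (u + 1) * (u + 1) := by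
          exact_mod_cast h
        field_simp
        linarith
      simp only [G]
      rw [h₁, h₂, h₃, h₄]
      have : (2 * (u : ℝ) + 1) ≠ 0 := by positivity
      push_cast
      field_simp
      ring
    have tel := Finset.sum_range_sub G N
    rw [← Finset.sum_congr rfl fun u _ => key u, sum_sub_distrib, ← mul_sum, ← mul_sum, ih] at tel
    have hG : G N - G 0 = 0 := by
      simp [G, Nat.choose_eq_zero_of_lt hN]
    rw [hG] at tel
    have h₀ : (2 * (n : ℝ) + 1) ≠ 0 := by positivity
    have h₁ : (2 * (n : ℝ) + 3) ≠ 0 := by positivity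
    have h₂ : (2 * ((n : ℝ) + 1) + 1) ≠ 0 := by positivity
    push_cast
    rw [mul_one_div_cancel h₀] at tel
    rw [eq_div_iff h₂]
    linarith

theorem card_filter_subset_powersetCard {α : Type*} [DecidableEq α] {L T : Finset α}
    (hL : L ⊆ T) {i : ℕ} (hi : i ≤ #T) :
    #{S ∈ powersetCard i T | L ⊆ S} = (#T - #L).choose (#T - i) := by
  rcases le_or_gt #L i with h | h
  · rw [card_filter_powersetCard_subset L T i hL h]
    exact Nat.choose_symm_of_eq_add (by lia)
  · rw [Nat.choose_eq_zero_of_lt (by have := card_le_card hL; lia), card_eq_zero,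
      filter_eq_empty_iff]
    intro S hS hLS
    have := card_le_card hLS
    rw [(mem_powersetCard.1 hS).2] at this
    lia

theorem choose_card_inter {α : Type*} [DecidableEq α] (U S : Finset α) (l : ℕ) :
    (#(U ∩ S)).choose l = #{L ∈ powersetCard l U | L ⊆ S} := by
  rw [← card_powersetCard]
  congr 1
  ext L
  simp [mem_powersetCard, subset_inter_iff]
  tauto

theorem sum_powersetCard_choose_card_inter {α : Type*} [DecidableEq α] (τ ρ : Finset α) (l : ℕ)
    {i : ℕ} (hi : i ≤ #τ) :
    ∑ S ∈ powersetCard i τ, (#(ρ ∩ S)).choose l =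
      (#(ρ ∩ τ)).choose l * (#τ - l).choose (#τ - i) := by
  have h₁ : ∀ S ∈ powersetCard i τ,
      (#(ρ ∩ S)).choose l = #{L ∈ powersetCard l (ρ ∩ τ) | L ⊆ S} := by
    intro S hS
    rw [← choose_card_inter, inter_assoc, inter_eq_right.2 (mem_powersetCard.1 hS).1]
  have h₂ : ∀ L ∈ powersetCard l (ρ ∩ τ),
      #{S ∈ powersetCard i τ | L ⊆ S} = (#τ - l).choose (#τ - i) := by
    intro L hL
    obtain ⟨hLτ, rfl⟩ := mem_powersetCard.1 hL
    exact card_filter_subset_powersetCard (hLτ.trans inter_subset_right) hi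
  rw [sum_congr rfl h₁]
  refine (sum_card_bipartiteAbove_eq_sum_card_bipartiteBelow fun S L : Finset α => L ⊆ S).trans ?_
  refine (sum_congr rfl h₂).trans ?_
  simp

theorem sum_superset_choose_card_inter {α : Type*} [Fintype α] [DecidableEq α] {m i : ℕ}
    (hα : Fintype.card α = 2 * m) {ρ τ : Finset α} (hτ : #τ = m) (hρ : #ρ ≤ m) (hi : i ≤ m) :
    ∑ σ ∈ powersetCard m univ with ρ ⊆ σ, (#(τ ∩ σ)).choose i =
      ∑ x ∈ antidiagonal m, (m - x.1).choose (m - i) * (2 * m - (i + #ρ)).choose x.2 *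
        (#(ρ ∩ τ)).choose x.1 := by
  calc
    _ = ∑ σ ∈ powersetCard m univ with ρ ⊆ σ, #{S ∈ powersetCard i τ | S ⊆ σ} :=
      sum_congr rfl fun σ _ => choose_card_inter τ σ i
    _ = ∑ S ∈ powersetCard i τ, #{σ ∈ {σ ∈ powersetCard m univ | ρ ⊆ σ} | S ⊆ σ} :=
      sum_card_bipartiteAbove_eq_sum_card_bipartiteBelow fun σ S : Finset α => S ⊆ σ
    _ = ∑ S ∈ powersetCard i τ, (#(ρ ∩ S) + (2 * m - (i + #ρ))).choose m := by
      refine sum_congr rfl fun S hS => ?_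
      have hS' := (mem_powersetCard.1 hS).2
      rw [filter_filter]
      simp_rw [← union_subset_iff]
      rw [card_filter_subset_powersetCard (subset_univ _) (by rw [card_univ, hα]; lia),
        card_univ, hα]
      have h₁ := card_union_add_card_inter ρ S
      have h₂ := card_le_card (inter_subset_left (s₁ := ρ) (s₂ := S))
      congr 1 <;> lia
    _ = _ := by
      simp_rw [Nat.add_choose_eq]
      rw [sum_comm]
      refine sum_congr rfl fun x _ => ?_
      rw [← sum_mul, sum_powersetCard_choose_card_inter τ ρ x.1 (hi.trans hτ.ge), hτ]
      ring

theorem intersection_matrix_entry {m p : ℕ} (hp : p ≤ m) :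
    (-1 : ℝ) ^ p * (Nat.doubleFactorial (2 * p) : ℝ)
      * (Nat.doubleFactorial (2 * m - 2 * p - 1) : ℝ)
      / (Nat.doubleFactorial (2 * m - 1) : ℝ) =
    (-1) ^ m * (2 * m + 1) *
      ∑ x ∈ antidiagonal m, (p.choose x.1 : ℝ) * ((-1) ^ x.2 / (2 * x.2 + 1)) := by
  obtain ⟨q, rfl⟩ := Nat.exists_eq_add_of_le hp
  rw [sum_antidiagonal_choose_mul_inv_odd, doubleFactorial_two_mul_add_one,
    show 2 * (p + q) - 2 * p - 1 = 2 * q - 1 by lia]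
  have h : ((2 * (p + q) - 1).doubleFactorial : ℝ) ≠ 0 := by
    exact_mod_cast (Nat.doubleFactorial_pos _).ne'
  have h' : (2 * ((p : ℝ) + q) + 1) ≠ 0 := by positivity
  have hq : ((-1 : ℝ) ^ q) * (-1) ^ q = 1 := by rw [← mul_pow]; simp
  push_cast
  rw [pow_add]
  field_simp
  linear_combination (-1) * hq

theorem intersection_matrix_eigenvalue_pos {α : Type*} [Fintype α] [DecidableEq α] {m : ℕ}
    (hα : Fintype.card α = 2 * m) {f : {s : Finset α // #s = m} → ℝ} (hf : f ≠ 0) {μ : ℝ}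
    (h : ∀ σ : {s : Finset α // #s = m}, ∑ τ : {s : Finset α // #s = m},
      (∑ x ∈ antidiagonal m, ((#(σ.1 ∩ τ.1)).choose x.1 : ℝ) * ((-1) ^ x.2 / (2 * x.2 + 1))) * f τ
        = μ * f σ) : 0 < μ := by
  let F : Finset α → ℝ := fun S => ∑ τ : {s : Finset α // #s = m}, if S ⊆ τ.1 then f τ else 0
  have hF : ∃ k, ∃ S, #S = k ∧ F S ≠ 0 := by
    obtain ⟨σ, hσ⟩ := Function.ne_iff.1 hf
    refine ⟨_, σ, rfl, ?_⟩
    simp only [F]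
    rw [Finset.sum_eq_single σ]
    · simpa using hσ
    · intro τ _ hne
      refine if_neg fun hs => hne (Subtype.ext (eq_of_subset_of_card_le hs ?_).symm)
      rw [σ.2, τ.2]
    · simp
  classical
  obtain ⟨ρ, hρ, hFρ⟩ := Nat.find_spec hF
  set k := Nat.find hF
  have hmin : ∀ S, #S < k → F S = 0 := fun S hS => by
    by_contra hne
    exact Nat.find_min hF hS ⟨S, rfl, hne⟩
  have hkm : k ≤ m := by
    by_contra! hk
    apply hFρ
    refine sum_eq_zero fun τ _ => if_neg fun hs => ?_
    have := card_le_card hs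
    rw [τ.2] at this
    lia
  have hsum (l : ℕ) : ∑ τ : {s : Finset α // #s = m}, ((#(ρ ∩ τ.1)).choose l : ℝ) * f τ =
      if l = k then F ρ else 0 := by
    have : ∀ τ : {s : Finset α // #s = m}, ((#(ρ ∩ τ.1)).choose l : ℝ) * f τ =
        ∑ L ∈ powersetCard l ρ, if L ⊆ τ.1 then f τ else 0 := by
      intro τ
      rw [choose_card_inter, ← sum_filter, sum_const, nsmul_eq_mul]
    rw [sum_congr rfl fun τ _ => this τ, sum_comm]
    change ∑ L ∈ powersetCard l ρ, F L = _
    rcases lt_trichotomy l k with hl | rfl | hl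
    · rw [if_neg hl.ne]
      exact sum_eq_zero fun L hL => hmin L ((mem_powersetCard.1 hL).2.trans_lt hl)
    · rw [if_pos rfl, ← hρ, powersetCard_self, sum_singleton]
    · rw [if_neg hl.ne', powersetCard_eq_empty.2 (hρ.trans_lt hl), sum_empty]
  have hcol (τ : {s : Finset α // #s = m}) {i : ℕ} (hi : i ≤ m) :
      ∑ σ : {s : Finset α // #s = m},
        (if ρ ⊆ σ.1 then ((#(σ.1 ∩ τ.1)).choose i : ℝ) else 0) =
      ∑ x ∈ antidiagonal m, ((m - x.1).choose (m - i) * (2 * m - (i + k)).choose x.2 : ℝ) *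
        (#(ρ ∩ τ.1)).choose x.1 := by
    have := sum_superset_choose_card_inter hα τ.2 (hρ.trans_le hkm) hi
    rw [sum_filter, Finset.sum_subtype (p := fun s : Finset α => #s = m) _ (by simp), hρ] at this
    simp_rw [inter_comm _ τ.1]
    rw [inter_comm] at this
    exact_mod_cast this
  have main : μ * F ρ = 1 / (2 * (m - k : ℕ) + 1) * F ρ := by
    calc
      μ * F ρ = ∑ σ : {s : Finset α // #s = m}, ∑ τ : {s : Finset α // #s = m},
          ∑ x ∈ antidiagonal m, (if ρ ⊆ σ.1 then ((#(σ.1 ∩ τ.1)).choose x.1 : ℝ) else 0) *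
            (((-1) ^ x.2 / (2 * x.2 + 1)) * f τ) := by
        rw [mul_sum]
        refine sum_congr rfl fun σ _ => ?_
        split_ifs with hs
        · rw [← h σ]
          refine sum_congr rfl fun τ _ => ?_
          rw [sum_mul]
          exact sum_congr rfl fun x _ => by ring
        · simp
      _ = ∑ x ∈ antidiagonal m, ∑ τ : {s : Finset α // #s = m},
          (∑ y ∈ antidiagonal m, ((m - y.1).choose (m - x.1) *
            (2 * m - (x.1 + k)).choose y.2 : ℝ) * (#(ρ ∩ τ.1)).choose y.1) *
            (((-1) ^ x.2 / (2 * x.2 + 1)) * f τ) := by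
        refine sum_comm.trans (Eq.trans (sum_congr rfl fun τ _ => ?_) sum_comm)
        rw [sum_comm]
        refine sum_congr rfl fun x hx => ?_
        rw [← hcol τ (HasAntidiagonal.mem_antidiagonal.1 hx ▸ Nat.le_add_right _ _), sum_mul]
      _ = ∑ x ∈ antidiagonal m, ((m - k).choose x.2 * (m - k + x.2).choose x.2 *
            ((-1) ^ x.2 / (2 * x.2 + 1))) * F ρ := by
        refine sum_congr rfl fun x hx => ?_
        have hx := mem_antidiagonal.1 hx
        simp_rw [sum_mul]
        rw [sum_comm, Finset.sum_eq_single (k, m - k)]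
        · have := hsum k
          rw [if_pos rfl] at this
          rw [← this, mul_sum]
          refine sum_congr rfl fun τ _ => ?_
          rw [show m - x.1 = x.2 by lia, show 2 * m - (x.1 + k) = m - k + x.2 by lia,
            Nat.choose_symm_add]
          ring
        · intro y hy hne
          have hyk : y.1 ≠ k := fun hyk => hne (Prod.ext hyk (by
            have := mem_antidiagonal.1 hy
            lia))
          have := hsum y.1
          rw [if_neg hyk] at this
          rw [← mul_zero (((m - y.1).choose (m - x.1) * (2 * m - (x.1 + k)).choose y.2 : ℝ) *
            ((-1) ^ x.2 / (2 * x.2 + 1))), ← this, mul_sum]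
          exact sum_congr rfl fun τ _ => by ring
        · intro hk
          exact absurd (HasAntidiagonal.mem_antidiagonal.2 (by lia)) hk
      _ = _ := by
        rw [← sum_mul, ← sum_choose_mul_choose_mul_inv_odd (m - k) (m + 1) (by lia)]
        rw [← Finset.Nat.sum_antidiagonal_swap, Finset.Nat.sum_antidiagonal_eq_sum_range_succ_mk]
        simp
  rw [mul_right_cancel₀ hFρ main]
  positivity

end

/-- With `b_p = (−1)^p (2p)!! (2m−2p−1)!! / (2m−1)!!`, the intersection matrix
`M_{σ,τ} = b_{|σ∩τ|}` on `m`-element subsets of a `2m`-element set is positive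
definite if `m` is even and negative definite if `m` is odd; in particular its
signature (number of positive minus number of negative eigenvalues, counted with
multiplicity as roots of the characteristic polynomial) is `(−1)^m · C(2m, m)`. -/
theorem intersection_matrix_definite (m : ℕ) (hm : 1 ≤ m) :
    let b : ℕ → ℝ := fun p => (-1 : ℝ) ^ p * (Nat.doubleFactorial (2 * p) : ℝ)
      * (Nat.doubleFactorial (2 * m - 2 * p - 1) : ℝ)
      / (Nat.doubleFactorial (2 * m - 1) : ℝ)
    let M := Matrix.of fun σ τ : {s : Finset (Fin (2 * m)) // s.card = m} =>
      b ((σ.1 ∩ τ.1).card)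
    (Even m → M.PosDef) ∧ (Odd m → (-M).PosDef) ∧
    (((M.charpoly.roots.filter fun x => 0 < x).card : ℤ)
        - ((M.charpoly.roots.filter fun x => x < 0).card : ℤ)
      = (-1 : ℤ) ^ m * ((2 * m).choose m : ℤ)) := by
  intro b M
  have hM : M.IsHermitian := by
    ext σ τ
    simp [M, Finset.inter_comm]
  have hpos {μ : ℝ} {f : {s : Finset (Fin (2 * m)) // s.card = m} → ℝ} (hf : f ≠ 0)
      (h : M.mulVec f = μ • f) : 0 < (-1) ^ m * μ := by
    have hc : (0 : ℝ) < 2 * m + 1 := by positivity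
    suffices 0 < (-1) ^ m * μ / (2 * m + 1) from (div_pos_iff_of_pos_right hc).1 this
    refine intersection_matrix_eigenvalue_pos (by simp) hf fun σ => ?_
    have hσ := congrFun h σ
    simp only [Matrix.mulVec, dotProduct, Pi.smul_apply, smul_eq_mul] at hσ
    rw [mul_div_right_comm, mul_assoc, ← hσ, Finset.mul_sum]
    refine Finset.sum_congr rfl fun τ _ => ?_
    have hle : (σ.1 ∩ τ.1).card ≤ m := (Finset.card_le_card Finset.inter_subset_left).trans σ.2.le
    simp only [M, b, Matrix.of_apply]
    rw [intersection_matrix_entry hle]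
    have hs : ((-1 : ℝ) ^ m) * (-1) ^ m = 1 := by rw [← mul_pow]; simp
    field_simp
    rw [sq, hs, mul_one]
  have hbasis {A : Matrix {s : Finset (Fin (2 * m)) // s.card = m} _ ℝ} (hA : A.IsHermitian)
      (i) : (hA.eigenvectorBasis i).ofLp ≠ 0 := fun h =>
    hA.eigenvectorBasis.orthonormal.ne_zero i (WithLp.ofLp_injective 2 h)
  have hev (i) : 0 < (-1) ^ m * hM.eigenvalues i :=
    hpos (hbasis hM i) (hM.mulVec_eigenvectorBasis i)
  refine ⟨fun he => ?_, fun ho => ?_, ?_⟩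
  · rw [hM.posDef_iff_eigenvalues_pos]
    simpa [he.neg_one_pow] using hev
  · rw [hM.neg.posDef_iff_eigenvalues_pos]
    intro i
    have h := hM.neg.mulVec_eigenvectorBasis i
    rw [Matrix.neg_mulVec, neg_eq_iff_eq_neg, ← neg_smul] at h
    simpa [ho.neg_one_pow] using hpos (hbasis hM.neg i) h
  · rw [hM.roots_charpoly_eq_eigenvalues, Multiset.filter_map, Multiset.filter_map,
      Multiset.card_map, Multiset.card_map]
    rcases Nat.even_or_odd m with he | ho
    · simp only [he.neg_one_pow, one_mul] at hev ⊢
      rw [Multiset.filter_eq_self.2 fun i _ => by simpa using hev i,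
        Multiset.filter_eq_nil.2 fun i _ => by simpa using (hev i).le]
      simp
    · simp only [ho.neg_one_pow, neg_mul, one_mul, Left.neg_pos_iff] at hev ⊢
      rw [Multiset.filter_eq_nil.2 fun i _ => by simpa using (hev i).le,
        Multiset.filter_eq_self.2 fun i _ => by simpa using hev i]
      simp
end
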